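/- arXiv:1610.00108 — 6 statements merged into one kernel-verified Lean document; each statement's English description precedes it below -/
import Mathlib

section
/- For every positive integer n, the bivariate Stern polynomial satisfies s_n(x,y) = s_{n^R}(x,y), where n^R is the integer obtained from n by reversing its binary expansion. -/
open MvPolynomial

/-- Bivariate Stern polynomials: `s 1 = 1`, `s (2n) = s n`,
`s (2n+1) = x * s n + y * s (n+1)`, where `x = X 0` and `y = X 1`
in `ℤ[x,y] = MvPolynomial (Fin 2) ℤ`. (The value at `0` is a junk value.) -/
noncomputable def sternPoly : ℕ → MvPolynomial (Fin 2) ℤ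
  | 0 => 0
  | 1 => 1
  | (n + 2) =>
      if (n + 2) % 2 = 0 then sternPoly ((n + 2) / 2)
      else X 0 * sternPoly ((n + 2) / 2) + X 1 * sternPoly ((n + 2) / 2 + 1)
decreasing_by all_goals omega

/-- `binRev n` is the integer obtained from `n` by reversing its binary expansion:
if `n = (ε_ν ε_{ν-1} … ε_0)₂` with `ε_ν = 1`, then `binRev n = Σ_{0 ≤ i ≤ ν} ε_{ν-i}·2^i`. -/
def binRev (n : ℕ) : ℕ := Nat.ofDigits 2 ((Nat.digits 2 n).reverse)

theorem sternPoly_two_mul (n : ℕ) : sternPoly (2 * n) = sternPoly n := by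
  rcases n with _ | n
  · rfl
  · rw [show 2 * (n + 1) = 2 * n + 2 by ring, sternPoly, if_pos (by omega),
      show (2 * n + 2) / 2 = n + 1 by omega]

theorem sternPoly_two_mul_add_one {n : ℕ} (hn : 1 ≤ n) :
    sternPoly (2 * n + 1) = X 0 * sternPoly n + X 1 * sternPoly (n + 1) := by
  obtain ⟨m, rfl⟩ := Nat.exists_eq_add_of_le' hn
  rw [show 2 * (m + 1) + 1 = (2 * m + 1) + 2 by ring, sternPoly, if_neg (by omega),
    show (2 * m + 1 + 2) / 2 = m + 1 by omega]

/-- The matrix sending `(s n, s (n + 1))` to `(s (2n + d), s (2n + d + 1))` for a binary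
digit `d`. -/
noncomputable def sternMatrix (d : ℕ) : Matrix (Fin 2) (Fin 2) (MvPolynomial (Fin 2) ℤ) :=
  if d = 0 then !![1, 0; X 0, X 1] else !![X 0, X 1; 0, 1]

/-- A symmetric matrix `P` such that `sternMatrix d * P` is symmetric for every `d`. -/
noncomputable def sternSymmetrizer : Matrix (Fin 2) (Fin 2) (MvPolynomial (Fin 2) ℤ) :=
  !![X 1 * (1 - X 1), X 0 * X 1; X 0 * X 1, X 0 * (1 - X 0)]

open Matrix

theorem transpose_sternSymmetrizer : sternSymmetrizerᵀ = sternSymmetrizer := by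
  ext i j : 1
  fin_cases i <;> fin_cases j <;> rfl

theorem sternMatrix_mul_sternSymmetrizer (d : ℕ) :
    sternMatrix d * sternSymmetrizer = sternSymmetrizer * (sternMatrix d)ᵀ := by
  unfold sternMatrix sternSymmetrizer
  split_ifs <;> ext i j : 1 <;> fin_cases i <;> fin_cases j <;>
    simp [Matrix.mul_apply, Fin.sum_univ_two] <;> ring

theorem sternSymmetrizer_mulVec :
    sternSymmetrizer *ᵥ ![X 0, X 1] = (X 0 * X 1 : MvPolynomial (Fin 2) ℤ) • ![1, 1] := by
  ext i : 1
  fin_cases i <;> simp [sternSymmetrizer, Matrix.mulVec, dotProduct, Fin.sum_univ_two] <;> ring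

theorem prod_sternMatrix_mul_sternSymmetrizer (w : List ℕ) :
    (w.map sternMatrix).prod * sternSymmetrizer =
      sternSymmetrizer * ((w.reverse.map sternMatrix).prod)ᵀ := by
  induction w with
  | nil => simp
  | cons d w ih =>
    simp only [List.map_cons, List.prod_cons, List.reverse_cons, List.map_append,
      List.prod_append, List.map_nil, List.prod_nil, mul_one, Matrix.transpose_mul]
    rw [mul_assoc, ih, ← mul_assoc, sternMatrix_mul_sternSymmetrizer, mul_assoc]

theorem one_le_ofDigits_append_one (w : List ℕ) : 1 ≤ Nat.ofDigits 2 (w ++ [1]) := by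
  rw [Nat.ofDigits_append, Nat.ofDigits_singleton, mul_one]
  exact le_add_left Nat.one_le_two_pow

theorem sternPoly_ofDigits_append_one (w : List ℕ) (hw : ∀ d ∈ w, d < 2) :
    ![sternPoly (Nat.ofDigits 2 (w ++ [1])), sternPoly (Nat.ofDigits 2 (w ++ [1]) + 1)] =
      (w.map sternMatrix).prod *ᵥ ![1, 1] := by
  induction w with
  | nil =>
    have h : sternPoly 2 = sternPoly 1 := sternPoly_two_mul 1
    simp [h, sternPoly]
  | cons d w ih =>
    have hN := one_le_ofDigits_append_one w
    rw [List.map_cons, List.prod_cons, ← Matrix.mulVec_mulVec,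
      ← ih fun e he => hw e (List.mem_cons_of_mem _ he), List.cons_append, Nat.ofDigits_cons]
    generalize Nat.ofDigits 2 (w ++ [1]) = N at hN
    have hd : d < 2 := hw d List.mem_cons_self
    interval_cases d
    · ext i : 1
      fin_cases i <;> simp [sternMatrix, Matrix.mulVec, dotProduct, Fin.sum_univ_two,
        sternPoly_two_mul, sternPoly_two_mul_add_one hN]
    · have h : sternPoly (1 + 2 * N + 1) = sternPoly (N + 1) := by
        rw [← sternPoly_two_mul (N + 1), show 1 + 2 * N + 1 = 2 * (N + 1) by ring]
      have h' : sternPoly (1 + 2 * N) = X 0 * sternPoly N + X 1 * sternPoly (N + 1) := by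
        rw [add_comm, sternPoly_two_mul_add_one hN]
      ext i : 1
      fin_cases i <;> simp [sternMatrix, Matrix.mulVec, dotProduct, Fin.sum_univ_two, h, h']

/-- Up to the factor `xy`, the polynomial of an odd index is the quadratic form of a matrix
product. -/
theorem sternPoly_ofDigits_one_cons (w : List ℕ) (hw : ∀ d ∈ w, d < 2) :
    X 0 * X 1 * sternPoly (Nat.ofDigits 2 (1 :: w ++ [1])) =
      ![X 0, X 1] ⬝ᵥ ((w.map sternMatrix).prod * sternSymmetrizer) *ᵥ ![X 0, X 1] := by
  rw [← Matrix.mulVec_mulVec, sternSymmetrizer_mulVec, Matrix.mulVec_smul,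
    ← sternPoly_ofDigits_append_one w hw, List.cons_append, Nat.ofDigits_cons,
    add_comm 1, sternPoly_two_mul_add_one (one_le_ofDigits_append_one w)]
  simp
  ring

theorem sternPoly_ofDigits_one_cons_reverse (w : List ℕ) (hw : ∀ d ∈ w, d < 2) :
    sternPoly (Nat.ofDigits 2 (1 :: w ++ [1])) =
      sternPoly (Nat.ofDigits 2 (1 :: w.reverse ++ [1])) := by
  have hxy : (X 0 * X 1 : MvPolynomial (Fin 2) ℤ) ≠ 0 := mul_ne_zero (X_ne_zero 0) (X_ne_zero 1)
  refine mul_left_cancel₀ hxy ?_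
  rw [sternPoly_ofDigits_one_cons w hw,
    sternPoly_ofDigits_one_cons w.reverse fun d hd => hw d (List.mem_reverse.1 hd),
    prod_sternMatrix_mul_sternSymmetrizer, ← transpose_sternSymmetrizer, ← Matrix.transpose_mul,
    transpose_sternSymmetrizer, Matrix.mulVec_transpose, dotProduct_comm,
    ← Matrix.dotProduct_mulVec]

theorem sternPoly_ofDigits_append_one_reverse (w : List ℕ) (hw : ∀ d ∈ w, d < 2) :
    sternPoly (Nat.ofDigits 2 (w ++ [1])) =
      sternPoly (Nat.ofDigits 2 (w ++ [1]).reverse) := by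
  induction w with
  | nil => rfl
  | cons d w ih =>
    have hw' : ∀ e ∈ w, e < 2 := fun e he => hw e (List.mem_cons_of_mem _ he)
    have hd : d < 2 := hw d List.mem_cons_self
    interval_cases d
    · rw [List.cons_append, List.reverse_cons, Nat.ofDigits_append, Nat.ofDigits_cons,
        Nat.ofDigits_singleton, zero_add, mul_zero, add_zero, sternPoly_two_mul,
        ih hw']
    · simpa using sternPoly_ofDigits_one_cons_reverse w hw'

/-- **Theorem 1.** The bivariate Stern polynomials are invariant under binary
digit reversal: `s n (x,y) = s (binRev n) (x,y)` for every positive integer `n`. -/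
theorem sternPoly_binRev (n : ℕ) (hn : 1 ≤ n) : sternPoly n = sternPoly (binRev n) := by
  have hne : Nat.digits 2 n ≠ [] := Nat.digits_ne_nil_iff_ne_zero.2 (by omega)
  have hlt : ∀ d ∈ Nat.digits 2 n, d < 2 := fun d hd => Nat.digits_lt_base one_lt_two hd
  have hlast : (Nat.digits 2 n).getLast hne = 1 := by
    have h0 := Nat.getLast_digit_ne_zero 2 (m := n) (by omega)
    have h2 := hlt _ (List.getLast_mem hne)
    omega
  have hdigits : (Nat.digits 2 n).dropLast ++ [1] = Nat.digits 2 n := by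
    rw [← hlast, List.dropLast_append_getLast]
  have h := sternPoly_ofDigits_append_one_reverse (Nat.digits 2 n).dropLast
    fun d hd => hlt d (List.mem_of_mem_dropLast hd)
  rwa [hdigits, Nat.ofDigits_digits] at h
end

section
/- For every positive integer n and all integers i, j ≥ 0, the number of proper hyperbinary expansions of n−1 with exactly i digits equal to 2 and j digits equal to 0 equals the corresponding count for n^R − 1; that is, h_n(i,j) = h_{n^R}(i,j). -/
open MvPolynomial

/-- `hyperCount t i j` is the number of proper hyperbinary expansions of `t - 1`
with exactly `i` digits equal to `2` and `j` digits equal to `0`.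
An expansion `(ε_{ν-1}, …, ε_0)` is encoded as the little-endian list
`L = [ε_0, …, ε_{ν-1}]` of digits in `{0,1,2}` with `Nat.ofDigits 2 L = t - 1`;
it is proper when it is empty or its leading digit `ε_{ν-1}` (the last entry
of `L`) is nonzero. -/
noncomputable def hyperCount (t i j : ℕ) : ℕ :=
  Nat.card {L : List ℕ // (∀ d ∈ L, d ≤ 2) ∧ Nat.ofDigits 2 L = t - 1 ∧
    L.getLast? ≠ some 0 ∧ L.count 2 = i ∧ L.count 0 = j}

namespace Hyperbinary

/-- Little-endian proper hyperbinary expansions of `m`. -/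
def expansions (m : ℕ) : Set (List ℕ) :=
  {L | (∀ d ∈ L, d ≤ 2) ∧ Nat.ofDigits 2 L = m ∧ L.getLast? ≠ some 0}

/-- The formal variable marking the digit `2`. -/
noncomputable def twoVar : Polynomial (Polynomial ℤ) := Polynomial.X

/-- The formal variable marking the digit `0`. -/
noncomputable def zeroVar : Polynomial (Polynomial ℤ) := Polynomial.C Polynomial.X

/-- The monomial recording the numbers of twos and zeros in a list of digits. -/
noncomputable def weight (L : List ℕ) : Polynomial (Polynomial ℤ) :=
  twoVar ^ L.count 2 * zeroVar ^ L.count 0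

/-- The generating polynomial of the proper hyperbinary expansions of `t - 1`. -/
noncomputable def genPoly (t : ℕ) : Polynomial (Polynomial ℤ) :=
  ∑ᶠ L ∈ expansions (t - 1), weight L

lemma nil_mem_expansions {m : ℕ} : [] ∈ expansions m ↔ m = 0 := by
  simp [expansions, eq_comm]

lemma cons_mem_expansions {d m : ℕ} {L : List ℕ} :
    d :: L ∈ expansions m ↔
      d ≤ 2 ∧ ∃ k, L ∈ expansions k ∧ d + 2 * k = m ∧ (d = 0 → k ≠ 0) := by
  rcases L with _ | ⟨e, L⟩
  · simp only [expansions, Set.mem_ofPred_eq, List.mem_singleton, forall_eq, Nat.ofDigits_cons,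
      Nat.ofDigits_nil, List.getLast?_singleton]
    simp
  · simp only [expansions, Set.mem_ofPred_eq, List.mem_cons, forall_eq_or_imp,
      Nat.ofDigits_cons (hd := d), List.getLast?_cons_cons]
    constructor
    · rintro ⟨⟨hd, he⟩, hm, hl⟩
      refine ⟨hd, _, ⟨he, rfl, hl⟩, hm, fun _ h0 => hl ?_⟩
      have hz : ∀ a ∈ e :: L, a = 0 := by
        clear he hm hl
        generalize e :: L = M at h0
        induction M with
        | nil => simp
        | cons a M ih =>
          rw [Nat.ofDigits_cons] at h0
          have h1 : a = 0 := by simpa using (Nat.add_eq_zero_iff.mp h0).1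
          have h2 : Nat.ofDigits 2 M = 0 := by simpa using (Nat.add_eq_zero_iff.mp h0).2
          simpa [h1] using ih h2
      rw [List.getLast?_eq_some_getLast (by simp)]
      exact congrArg some (hz _ (List.getLast_mem _))
    · rintro ⟨hd, k, ⟨he, hk, hl⟩, hm, -⟩
      exact ⟨⟨hd, he⟩, by simpa [Nat.ofDigits_cons (hd := d), hk] using hm, hl⟩

lemma expansions_zero : expansions 0 = {[]} := by
  ext L
  rcases L with _ | ⟨d, L⟩
  · simp [nil_mem_expansions]
  · simp only [cons_mem_expansions, Set.mem_singleton_iff, reduceCtorEq, iff_false]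
    grind

lemma expansions_odd (k : ℕ) : expansions (2 * k + 1) = List.cons 1 '' expansions k := by
  ext L
  rcases L with _ | ⟨d, L⟩
  · simp [nil_mem_expansions]
  · simp only [cons_mem_expansions, Set.mem_image, List.cons.injEq]
    constructor
    · rintro ⟨hd, l, hl, h, -⟩
      obtain rfl : l = k := by omega
      exact ⟨L, hl, by omega, rfl⟩
    · rintro ⟨M, hM, rfl, rfl⟩
      exact ⟨by omega, k, hM, by omega, by omega⟩

lemma expansions_even (k : ℕ) : expansions (2 * k + 2) =
    List.cons 0 '' expansions (k + 1) ∪ List.cons 2 '' expansions k := by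
  ext L
  rcases L with _ | ⟨d, L⟩
  · simp [nil_mem_expansions]
  · simp only [cons_mem_expansions, Set.mem_union, Set.mem_image, List.cons.injEq]
    constructor
    · rintro ⟨hd, l, hl, h, -⟩
      obtain ⟨rfl, rfl⟩ | ⟨rfl, rfl⟩ : (d = 0 ∧ l = k + 1) ∨ (d = 2 ∧ l = k) := by omega
      · exact Or.inl ⟨L, hl, rfl, rfl⟩
      · exact Or.inr ⟨L, hl, rfl, rfl⟩
    · rintro (⟨M, hM, rfl, rfl⟩ | ⟨M, hM, rfl, rfl⟩)
      · exact ⟨by omega, k + 1, hM, by omega, by omega⟩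
      · exact ⟨by omega, k, hM, by omega, by omega⟩

lemma finite_expansions (m : ℕ) : (expansions m).Finite := by
  induction m using Nat.strong_induction_on with
  | _ m ih =>
    obtain ⟨k, rfl | rfl⟩ := m.even_or_odd'
    · rcases k with _ | k
      · simp [expansions_zero]
      · rw [mul_add, mul_one, expansions_even]
        exact ((ih _ (by omega)).image _).union ((ih _ (by omega)).image _)
    · rw [expansions_odd]
      exact (ih _ (by omega)).image _

lemma genPoly_one : genPoly 1 = 1 := by
  simp [genPoly, expansions_zero, weight]

lemma finsum_weight_cons (d k : ℕ) :
    ∑ᶠ L ∈ List.cons d '' expansions k, weight L = weight [d] * ∑ᶠ L ∈ expansions k, weight L := by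
  rw [finsum_mem_image List.cons_injective.injOn, mul_finsum_mem]
  refine finsum_mem_congr rfl fun L _ => ?_
  rw [weight, weight, weight, ← List.singleton_append, List.count_append, List.count_append]
  ring

lemma genPoly_two_mul {m : ℕ} (hm : 1 ≤ m) : genPoly (2 * m) = genPoly m := by
  obtain ⟨k, rfl⟩ := Nat.exists_eq_add_of_le' hm
  have h : 2 * (k + 1) - 1 = 2 * k + 1 := by omega
  rw [genPoly, genPoly, h, expansions_odd, finsum_weight_cons]
  simp [weight]

lemma genPoly_two_mul_add_one {m : ℕ} (hm : 1 ≤ m) :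
    genPoly (2 * m + 1) = twoVar * genPoly m + zeroVar * genPoly (m + 1) := by
  obtain ⟨k, rfl⟩ := Nat.exists_eq_add_of_le' hm
  have h : 2 * (k + 1) + 1 - 1 = 2 * k + 2 := by omega
  rw [genPoly, genPoly, genPoly, h, expansions_even, finsum_mem_union, finsum_weight_cons,
    finsum_weight_cons]
  · simp [weight, add_comm]
  · rw [Set.disjoint_left]
    rintro _ ⟨L, -, rfl⟩ ⟨M, -, h⟩
    simp at h
  · exact (finite_expansions _).image _
  · exact (finite_expansions _).image _

lemma coeff_weight (L : List ℕ) (i j : ℕ) :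
    ((weight L).coeff i).coeff j = if L.count 2 = i ∧ L.count 0 = j then 1 else 0 := by
  rw [weight, twoVar, zeroVar, ← Polynomial.C_pow, Polynomial.coeff_mul_C, Polynomial.coeff_X_pow]
  split_ifs <;> simp_all [Polynomial.coeff_X_pow, eq_comm]

lemma coeff_genPoly (t i j : ℕ) : ((genPoly t).coeff i).coeff j = hyperCount t i j := by
  have h := finite_expansions (t - 1)
  rw [genPoly, finsum_mem_eq_finite_toFinset_sum _ h, Polynomial.finsetSum_coeff,
    Polynomial.finsetSum_coeff]
  simp only [coeff_weight]
  rw [Finset.sum_boole, hyperCount, ← Nat.card_eq_finsetCard]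
  congr 1
  refine Nat.card_congr (Equiv.subtypeEquivRight fun L => ?_)
  simp [expansions, and_assoc]

section Transfer

variable {R : Type*} [CommRing R]

/-- How prepending a least significant binary digit `d` to `m` transforms the pair of
generating polynomials at `m` and `m + 1`. -/
def digitStep (x y : R) (d : ℕ) (v : R × R) : R × R :=
  if d = 0 then (v.1, x * v.1 + y * v.2) else (x * v.1 + y * v.2, v.2)

/-- A symmetric bilinear form for which every `digitStep` is self-adjoint. -/
def digitForm (x y : R) (u v : R × R) : R :=
  x * (x - 1) * (u.1 * v.1) + x * y * (u.1 * v.2 + u.2 * v.1) + y * (y - 1) * (u.2 * v.2)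

lemma digitForm_comm (x y : R) (u v : R × R) : digitForm x y u v = digitForm x y v u := by
  simp only [digitForm]
  ring

lemma digitForm_digitStep (x y : R) (d : ℕ) (u v : R × R) :
    digitForm x y (digitStep x y d u) v = digitForm x y u (digitStep x y d v) := by
  unfold digitForm digitStep
  split_ifs <;> ring

lemma digitForm_one_right (x y : R) (u : R × R) :
    digitForm x y u (1, 1) = (x + y - 1) * (x * u.1 + y * u.2) := by
  simp only [digitForm]
  ring

lemma digitForm_foldr_reverse (x y : R) (w : List ℕ) (u v : R × R) :
    digitForm x y (w.foldr (digitStep x y) u) v =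
      digitForm x y u (w.reverse.foldr (digitStep x y) v) := by
  induction w generalizing v with
  | nil => rfl
  | cons d w ih => simp [digitForm_digitStep, ih]

end Transfer

lemma genPoly_pair_foldr (w : List ℕ) (hw : ∀ d ∈ w, d < 2) :
    (genPoly (Nat.ofDigits 2 (w ++ [1])), genPoly (Nat.ofDigits 2 (w ++ [1]) + 1)) =
      w.foldr (digitStep twoVar zeroVar) (1, 1) ∧ 1 ≤ Nat.ofDigits 2 (w ++ [1]) := by
  induction w with
  | nil =>
    have h2 : genPoly (1 + 1) = 1 := by rw [← genPoly_one, ← genPoly_two_mul le_rfl]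
    simp [genPoly_one, h2]
  | cons d w ih =>
    obtain ⟨ih, hpos⟩ := ih fun e he => hw e (List.mem_cons_of_mem _ he)
    rw [List.foldr_cons, ← ih, List.cons_append, Nat.ofDigits_cons]
    generalize Nat.ofDigits 2 (w ++ [1]) = m at hpos
    have hd := hw d List.mem_cons_self
    interval_cases d
    · simp only [digitStep, zero_add, genPoly_two_mul hpos,
        genPoly_two_mul_add_one hpos]
      exact ⟨rfl, by omega⟩
    · have h : 1 + 2 * m + 1 = 2 * (m + 1) := by ring
      rw [h, genPoly_two_mul (Nat.le_add_left 1 m), add_comm 1, genPoly_two_mul_add_one hpos]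
      exact ⟨rfl, by omega⟩

lemma genPoly_ofDigits_reverse (w : List ℕ) (hw : ∀ d ∈ w, d < 2) :
    genPoly (Nat.ofDigits 2 (1 :: (w ++ [1]))) =
      genPoly (Nat.ofDigits 2 (1 :: (w.reverse ++ [1]))) := by
  have step (u : List ℕ) (hu : ∀ d ∈ u, d < 2) :
      (twoVar + zeroVar - 1) * genPoly (Nat.ofDigits 2 (1 :: (u ++ [1]))) =
        digitForm twoVar zeroVar (u.foldr (digitStep twoVar zeroVar) (1, 1)) (1, 1) := by
    obtain ⟨h, hpos⟩ := genPoly_pair_foldr u hu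
    rw [← h, digitForm_one_right, Nat.ofDigits_cons, add_comm 1,
      genPoly_two_mul_add_one hpos]
  have hne : twoVar + zeroVar - 1 ≠ 0 := fun h => by
    have := congrArg (fun p => p.coeff 1) h
    simp [twoVar, zeroVar, Polynomial.coeff_one] at this
  refine mul_left_cancel₀ hne ?_
  rw [step w hw, step w.reverse (by simpa using hw), digitForm_foldr_reverse, digitForm_comm]

lemma binRev_two_mul {m : ℕ} (hm : 1 ≤ m) : binRev (2 * m) = binRev m := by
  rw [binRev, Nat.digits_def' one_lt_two (by omega)]
  simp [binRev, Nat.ofDigits_append]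

lemma genPoly_binRev {n : ℕ} (hn : 1 ≤ n) : genPoly n = genPoly (binRev n) := by
  induction n using Nat.strong_induction_on with
  | _ n ih =>
    obtain ⟨m, rfl | rfl⟩ := n.even_or_odd'
    · rw [genPoly_two_mul (by omega), binRev_two_mul (by omega)]
      exact ih m (by omega) (by omega)
    · rcases Nat.eq_zero_or_pos m with rfl | hm
      · simp [binRev]
      · have hdig : Nat.digits 2 (2 * m + 1) = 1 :: Nat.digits 2 m := by
          rw [add_comm]
          exact Nat.digits_add 2 one_lt_two 1 m one_lt_two (Or.inl one_ne_zero)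
        have hne : Nat.digits 2 m ≠ [] := Nat.digits_ne_nil_iff_ne_zero.mpr hm.ne'
        have hlast : (Nat.digits 2 m).getLast hne = 1 := by
          have h0 := Nat.getLast_digit_ne_zero 2 hm.ne'
          have h2 := Nat.digits_lt_base one_lt_two (List.getLast_mem hne)
          omega
        have happ := List.dropLast_append_getLast hne
        rw [hlast] at happ
        have key := genPoly_ofDigits_reverse (Nat.digits 2 m).dropLast fun d hd =>
          Nat.digits_lt_base one_lt_two (List.mem_of_mem_dropLast hd)
        have hrev : binRev (2 * m + 1) =
            Nat.ofDigits 2 (1 :: ((Nat.digits 2 m).dropLast.reverse ++ [1])) := by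
          rw [binRev, hdig, ← happ]
          simp
        rw [hrev, ← key, happ, ← hdig, Nat.ofDigits_digits]

end Hyperbinary

/-- **Corollary.** For every positive integer `n` and all `i, j ≥ 0`, the number of
proper hyperbinary expansions of `n - 1` with exactly `i` twos and `j` zeros equals
the corresponding count for `binRev n - 1`. -/
theorem hyperCount_binRev (n : ℕ) (hn : 1 ≤ n) (i j : ℕ) :
    hyperCount n i j = hyperCount (binRev n) i j := by
  exact_mod_cast (Hyperbinary.coeff_genPoly n i j).symm.trans
    (Hyperbinary.genPoly_binRev hn ▸ Hyperbinary.coeff_genPoly (binRev n) i j)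
end

section
/- For every ν ≥ 1 and every finite sequence (ε_1, …, ε_{ν−1}) with values in {0,1}, the identity (x y)·A(ε_1)···A(ε_{ν−1})·(1,1)ᵗ = (1 1)·ᵗA(ε_1)···ᵗA(ε_{ν−1})·(x,y)ᵗ holds in ℤ[x,y], where A(0) = [[1,0],[x,y]], A(1) = [[x,y],[0,1]], and ᵗM denotes the transpose of M. -/
open MvPolynomial Matrix

/-- `Adig 0 = A(0) = [[1,0],[x,y]]` and `Adig e = A(1) = [[x,y],[0,1]]` for `e ≠ 0`. -/
noncomputable def Adig (e : ℕ) : Matrix (Fin 2) (Fin 2) (MvPolynomial (Fin 2) ℤ) :=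
  if e = 0 then !![1, 0; X 0, X 1] else !![X 0, X 1; 0, 1]

/-- The row vector `(x y)` over `ℤ[x,y]`. -/
noncomputable def rowXY : Matrix (Fin 1) (Fin 2) (MvPolynomial (Fin 2) ℤ) := !![X 0, X 1]

/-- The row vector `(1 1)` over `ℤ[x,y]`. -/
noncomputable def row11 : Matrix (Fin 1) (Fin 2) (MvPolynomial (Fin 2) ℤ) := !![1, 1]

/-- The column vector `(x, y)ᵗ` over `ℤ[x,y]`. -/
noncomputable def colXY : Matrix (Fin 2) (Fin 1) (MvPolynomial (Fin 2) ℤ) := !![X 0; X 1]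

/-- The column vector `(1, 1)ᵗ` over `ℤ[x,y]`. -/
noncomputable def col11 : Matrix (Fin 2) (Fin 1) (MvPolynomial (Fin 2) ℤ) := !![1; 1]

/-- A symmetric matrix intertwining each `Adig e` with its transpose. -/
noncomputable def intertwiner : Matrix (Fin 2) (Fin 2) (MvPolynomial (Fin 2) ℤ) :=
  !![X 0 * (X 0 - 1), X 0 * X 1; X 0 * X 1, X 1 * (X 1 - 1)]

lemma intertwiner_mul_Adig (e : ℕ) : intertwiner * Adig e = (Adig e)ᵀ * intertwiner := by
  unfold intertwiner Adig
  split_ifs <;> ext1 i j <;> fin_cases i <;> fin_cases j <;>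
    simp [Matrix.mul_apply, Fin.sum_univ_two] <;> ring

lemma intertwiner_mul_prod (L : List ℕ) :
    intertwiner * (L.map Adig).prod = (L.map (fun e => (Adig e)ᵀ)).prod * intertwiner := by
  induction L with
  | nil => simp
  | cons e L ih =>
    simp only [List.map_cons, List.prod_cons]
    rw [← Matrix.mul_assoc, intertwiner_mul_Adig, Matrix.mul_assoc, ih, Matrix.mul_assoc]

lemma row11_mul_intertwiner :
    row11 * intertwiner = (X 0 + X 1 - 1 : MvPolynomial (Fin 2) ℤ) • rowXY := by
  unfold row11 intertwiner rowXY
  ext1 i j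
  fin_cases i; fin_cases j <;> simp [Matrix.mul_apply, Fin.sum_univ_two] <;> ring

lemma intertwiner_mul_col11 :
    intertwiner * col11 = (X 0 + X 1 - 1 : MvPolynomial (Fin 2) ℤ) • colXY := by
  unfold col11 intertwiner colXY
  ext1 i j
  fin_cases j; fin_cases i <;> simp [Matrix.mul_apply, Fin.sum_univ_two] <;> ring

lemma X_add_X_sub_one_ne_zero : (X 0 + X 1 - 1 : MvPolynomial (Fin 2) ℤ) ≠ 0 := by
  intro h
  simpa using congrArg (eval 0) h

/-- For every finite sequence `(ε_1, …, ε_{ν-1})` with values in `{0,1}`,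
`(x y)·A(ε_1)···A(ε_{ν-1})·(1,1)ᵗ = (1 1)·ᵗA(ε_1)···ᵗA(ε_{ν-1})·(x,y)ᵗ` in `ℤ[x,y]`. -/
theorem rowvec_prod_reversal (L : List ℕ) (hL : ∀ e ∈ L, e ≤ 1) :
    rowXY * (L.map Adig).prod * col11
      = row11 * (L.map (fun e => (Adig e)ᵀ)).prod * colXY := by
  ext1 i j
  refine mul_left_cancel₀ X_add_X_sub_one_ne_zero ?_
  rw [← smul_eq_mul, ← smul_eq_mul, ← Matrix.smul_apply, ← Matrix.smul_apply,
    ← Matrix.smul_mul, ← Matrix.smul_mul, ← row11_mul_intertwiner, Matrix.mul_assoc row11,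
    intertwiner_mul_prod, ← Matrix.mul_assoc, Matrix.mul_assoc _ intertwiner,
    intertwiner_mul_col11, Matrix.mul_smul]
end

section
/- For all integers n ≥ 1 and all i, j ≥ 0, h_{2n}(i,j) = h_n(i,j). -/
open MvPolynomial

/-- A base-two expansion of `2 * n - 1` with digits at most `2` has lowest digit `1`, and its
remaining digits represent `n - 1`. -/
theorem exists_eq_one_cons_of_ofDigits_two_mul_sub_one {n : ℕ} (hn : 1 ≤ n) {L : List ℕ}
    (hd : ∀ d ∈ L, d ≤ 2) (hL : Nat.ofDigits 2 L = 2 * n - 1) :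
    ∃ M : List ℕ, L = 1 :: M ∧ Nat.ofDigits 2 M = n - 1 := by
  cases L with
  | nil => simp at hL; omega
  | cons a M =>
    have ha : a ≤ 2 := hd a (by simp)
    rw [Nat.ofDigits_cons] at hL
    obtain rfl : a = 1 := by omega
    exact ⟨M, rfl, by omega⟩

/-- For all `n ≥ 1` and all `i, j ≥ 0`, `h_{2n}(i,j) = h_n(i,j)`. -/
theorem hyperCount_two_mul (n : ℕ) (hn : 1 ≤ n) (i j : ℕ) :
    hyperCount (2 * n) i j = hyperCount n i j := by
  symm
  refine Nat.card_congr (Equiv.ofBijective (Subtype.map (List.cons 1) ?_)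
    ⟨Subtype.map_injective _ List.cons_injective, ?_⟩)
  · rintro L ⟨hd, hL, hlast, h2, h0⟩
    refine ⟨by simpa using hd, ?_, ?_, by simpa using h2, by simpa using h0⟩
    · rw [Nat.ofDigits_cons]; omega
    · cases L with
      | nil => simp
      | cons a L => simpa [List.getLast?_cons_cons] using hlast
  · rintro ⟨L, hd, hL, hlast, h2, h0⟩
    obtain ⟨M, rfl, hM⟩ := exists_eq_one_cons_of_ofDigits_two_mul_sub_one hn hd hL
    refine ⟨⟨M, fun d h => hd d (by simp [h]), hM, ?_, by simpa using h2, by simpa using h0⟩, rfl⟩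
    cases M with
    | nil => simp
    | cons a M => simpa [List.getLast?_cons_cons] using hlast
end

section
/- For all integers n ≥ 1 and all i ≥ 1, h_{2n+1}(i,0) = h_n(i−1,0). -/
open MvPolynomial

/-- For all `n ≥ 1` and all `i ≥ 1`, `h_{2n+1}(i,0) = h_n(i-1,0)`. -/
theorem hyperCount_odd_zero_right (n : ℕ) (hn : 1 ≤ n) (i : ℕ) (hi : 1 ≤ i) :
    hyperCount (2 * n + 1) i 0 = hyperCount n (i - 1) 0 := by
  obtain ⟨n, rfl⟩ : ∃ m, n = m + 1 := ⟨n - 1, by omega⟩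
  obtain ⟨i, rfl⟩ : ∃ k, i = k + 1 := ⟨i - 1, by omega⟩
  symm
  unfold hyperCount
  refine Nat.card_congr (Equiv.ofBijective (fun L => ⟨2 :: L.1, ?_⟩) ⟨?_, ?_⟩)
  · obtain ⟨L, hd, hs, -, h2, h0⟩ := L
    have hlast : (2 :: L).getLast? ≠ some 0 := fun h => by
      have hmem := List.mem_of_getLast? h
      simp only [List.mem_cons, OfNat.zero_ne_ofNat, false_or] at hmem
      exact List.count_eq_zero.mp h0 hmem
    refine ⟨by simpa using hd, ?_, hlast, by simpa using h2, by simpa using h0⟩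
    rw [Nat.ofDigits_cons, hs]
    push_cast
    omega
  · rintro ⟨L, hL⟩ ⟨M, hM⟩ h
    simpa using h
  · rintro ⟨L, hd, hs, -, h2, h0⟩
    cases L with
    | nil => simp at h2
    | cons d L =>
      have hd0 : d ≠ 0 := by rintro rfl; simp at h0
      have hd2 : d ≤ 2 := hd d (by simp)
      rw [Nat.ofDigits_cons] at hs
      push_cast at hs
      obtain rfl : d = 2 := by omega
      have hL0 : L.count 0 = 0 := by simpa using h0
      refine ⟨⟨L, fun e he => hd e (by simp [he]), by omega, fun h => ?_,
        by simpa using h2, hL0⟩, rfl⟩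
      exact List.count_eq_zero.mp hL0 (List.mem_of_getLast? h)
end

section
/- For all integers n ≥ 1 and all i, j ≥ 1, h_{2n+1}(i,j) = h_n(i−1,j) + h_{n+1}(i,j−1). -/
open MvPolynomial

/-- The proper hyperbinary expansions of `m` with `i` digits `2` and `j` digits `0`,
as little-endian digit lists. -/
def hyperExpansions (m i j : ℕ) : Set (List ℕ) :=
  {L | (∀ d ∈ L, d ≤ 2) ∧ Nat.ofDigits 2 L = m ∧ L.getLast? ≠ some 0 ∧
    L.count 2 = i ∧ L.count 0 = j}

theorem hyperCount_eq_ncard (t i j : ℕ) :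
    hyperCount t i j = (hyperExpansions (t - 1) i j).ncard := rfl

theorem length_le_ofDigits_two_of_getLast?_ne_zero (L : List ℕ) (h : L.getLast? ≠ some 0) :
    L.length ≤ Nat.ofDigits 2 L := by
  induction L with
  | nil => simp
  | cons d L ih =>
    cases L with
    | nil =>
      have hd : d ≠ 0 := by simpa using h
      simpa using Nat.one_le_iff_ne_zero.mpr hd
    | cons e L =>
      rw [List.getLast?_cons_cons] at h
      have hlen := ih h
      rw [Nat.ofDigits_cons]
      simp only [List.length_cons] at hlen ⊢
      omega

theorem finite_hyperExpansions (m i j : ℕ) : (hyperExpansions m i j).Finite := by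
  refine ((List.finite_length_le (Fin 3) m).image (List.map Fin.val)).subset ?_
  rintro L ⟨hd, hm, hl, -, -⟩
  refine ⟨L.map (Fin.ofNat 3), ?_, ?_⟩
  · simpa [← hm] using length_le_ofDigits_two_of_getLast?_ne_zero L hl
  · rw [List.map_map]
    refine (List.map_congr_left fun d hdL => ?_).trans (List.map_id L)
    have := hd d hdL
    simp only [Function.comp_apply, Fin.val_ofNat, id]
    omega

theorem cons_two_mem_hyperExpansions_iff {m i j : ℕ} (hm : 1 ≤ m) (hi : 1 ≤ i) (L : List ℕ) :
    2 :: L ∈ hyperExpansions (2 * m) i j ↔ L ∈ hyperExpansions (m - 1) (i - 1) j := by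
  have hlast : (2 :: L).getLast? ≠ some 0 ↔ L.getLast? ≠ some 0 := by
    cases L <;> simp [List.getLast?_cons_cons]
  have hval : 2 + 2 * Nat.ofDigits 2 L = 2 * m ↔ Nat.ofDigits 2 L = m - 1 := by omega
  have hcount : L.count 2 + 1 = i ↔ L.count 2 = i - 1 := by omega
  simp only [hyperExpansions, Set.mem_ofPred_eq, hlast, Nat.ofDigits_cons, hval]
  simp [hcount]

theorem cons_zero_mem_hyperExpansions_iff {m i j : ℕ} (hm : 1 ≤ m) (hj : 1 ≤ j) (L : List ℕ) :
    0 :: L ∈ hyperExpansions (2 * m) i j ↔ L ∈ hyperExpansions m i (j - 1) := by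
  cases L with
  | nil => simp [hyperExpansions]; omega
  | cons e L =>
    have hval : Nat.ofDigits 2 (0 :: e :: L) = 2 * m ↔ Nat.ofDigits 2 (e :: L) = m := by
      rw [Nat.ofDigits_cons]
      omega
    have hcount : (e :: L).count 0 + 1 = j ↔ (e :: L).count 0 = j - 1 := by omega
    simp only [hyperExpansions, Set.mem_ofPred_eq, List.getLast?_cons_cons,
      hval, List.count_cons_self, hcount]
    simp

theorem hyperExpansions_two_mul {m i j : ℕ} (hm : 1 ≤ m) (hi : 1 ≤ i) (hj : 1 ≤ j) :
    hyperExpansions (2 * m) i j =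
      List.cons 2 '' hyperExpansions (m - 1) (i - 1) j ∪
        List.cons 0 '' hyperExpansions m i (j - 1) := by
  ext L
  constructor
  · intro h
    cases L with
    | nil =>
      have := h.2.1
      simp at this
      omega
    | cons d L =>
      have hd : d ≤ 2 := h.1 d (by simp)
      have hval := h.2.1
      rw [Nat.ofDigits_cons] at hval
      obtain rfl | rfl : d = 2 ∨ d = 0 := by omega
      · exact Or.inl ⟨L, (cons_two_mem_hyperExpansions_iff hm hi L).mp h, rfl⟩
      · exact Or.inr ⟨L, (cons_zero_mem_hyperExpansions_iff hm hj L).mp h, rfl⟩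
  · rintro (⟨L, h, rfl⟩ | ⟨L, h, rfl⟩)
    · exact (cons_two_mem_hyperExpansions_iff hm hi L).mpr h
    · exact (cons_zero_mem_hyperExpansions_iff hm hj L).mpr h

/-- For all `n ≥ 1` and all `i, j ≥ 1`, `h_{2n+1}(i,j) = h_n(i-1,j) + h_{n+1}(i,j-1)`. -/
theorem hyperCount_odd (n : ℕ) (hn : 1 ≤ n) (i j : ℕ) (hi : 1 ≤ i) (hj : 1 ≤ j) :
    hyperCount (2 * n + 1) i j = hyperCount n (i - 1) j + hyperCount (n + 1) i (j - 1) := by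
  have hdisj : Disjoint (List.cons 2 '' hyperExpansions (n - 1) (i - 1) j)
      (List.cons 0 '' hyperExpansions n i (j - 1)) := by
    rw [Set.disjoint_left]
    rintro _ ⟨L, -, rfl⟩ ⟨L', -, h⟩
    simp at h
  simp only [hyperCount_eq_ncard, Nat.add_sub_cancel]
  rw [hyperExpansions_two_mul hn hi hj, Set.ncard_union_eq hdisj
    ((finite_hyperExpansions _ _ _).image _) ((finite_hyperExpansions _ _ _).image _),
    Set.ncard_image_of_injective _ List.cons_injective,
    Set.ncard_image_of_injective _ List.cons_injective]
end
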